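/- The class L_{msc} of multilinearly sequentially continuous operators is a closed hyper-ideal whose linear component is the ideal of completely continuous operators, and it contains the composition class CC∘L. Explicitly: (a) each component L_{msc}(E1,…,En;F) is a linear subspace of L(E1,…,En;F) containing the finite-rank operators and closed in the operator norm; (b) hyper-ideal property: for naturals 1 ≤ m1 < ⋯ < mn, continuous multilinear B1 ∈ L(G1,…,G_{m1};E1), …, Bn ∈ L(G_{m_{n-1}+1},…,G_{mn};En), A ∈ L_{msc}(E1,…,En;F) and continuous linear t ∈ L(F;H0), the operator t∘A∘(B1,…,Bn) is multilinearly sequentially continuous; (c) a continuous linear operator is multilinearly sequentially continuous if and only if it is completely continuous; (d) if A = u∘B with B ∈ L(E1,…,En;G) continuous multilinear and u : G → F completely continuous linear, then A is multilinearly sequentially continuous. -/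

import Mathlib

open Filter Topology
open scoped ENNReal NNReal BigOperators

noncomputable section

/-- The type of classes of continuous multilinear operators between Banach spaces:
one set of continuous `n`-linear operators for each `n` and each tuple of Banach spaces
`E₁, …, Eₙ, F` over `𝕜`. -/
abbrev MultiClass (𝕜 : Type) [RCLike 𝕜] : Type 1 :=
  ∀ (n : ℕ) (E : Fin n → Type) [∀ i, NormedAddCommGroup (E i)] [∀ i, NormedSpace 𝕜 (E i)]
    [∀ i, CompleteSpace (E i)]
    (F : Type) [NormedAddCommGroup F] [NormedSpace 𝕜 F] [CompleteSpace F],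
    Set (ContinuousMultilinearMap 𝕜 E F)

/-- A real-valued "norm" function defined on all continuous multilinear operators
between Banach spaces. -/
abbrev MultiNorm (𝕜 : Type) [RCLike 𝕜] : Type 1 :=
  ∀ (n : ℕ) (E : Fin n → Type) [∀ i, NormedAddCommGroup (E i)] [∀ i, NormedSpace 𝕜 (E i)]
    [∀ i, CompleteSpace (E i)]
    (F : Type) [NormedAddCommGroup F] [NormedSpace 𝕜 F] [CompleteSpace F],
    ContinuousMultilinearMap 𝕜 E F → ℝ

variable (𝕜 : Type) [RCLike 𝕜]

/-- The finite type multilinear operators: the linear span of the operators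
`(x₁,…,xₙ) ↦ φ₁(x₁)⋯φₙ(xₙ) • y` with `φᵢ ∈ Eᵢ'`, `y ∈ F`. -/
def IsFiniteType {n : ℕ} {E : Fin n → Type} [∀ i, NormedAddCommGroup (E i)]
    [∀ i, NormedSpace 𝕜 (E i)] {F : Type} [NormedAddCommGroup F] [NormedSpace 𝕜 F]
    (A : ContinuousMultilinearMap 𝕜 E F) : Prop :=
  A ∈ Submodule.span 𝕜 {B : ContinuousMultilinearMap 𝕜 E F |
      ∃ (φ : ∀ i, E i →L[𝕜] 𝕜) (y : F), ∀ x, B x = (∏ i, φ i (x i)) • y}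

/-- A multilinear operator has finite rank if its range spans a finite-dimensional
subspace of the target space. -/
def IsFiniteRank {n : ℕ} {E : Fin n → Type} [∀ i, NormedAddCommGroup (E i)]
    [∀ i, NormedSpace 𝕜 (E i)] {F : Type} [NormedAddCommGroup F] [NormedSpace 𝕜 F]
    (A : ContinuousMultilinearMap 𝕜 E F) : Prop :=
  FiniteDimensional 𝕜 (Submodule.span 𝕜 (Set.range (⇑A)))

/-- `IsBlockComp 𝕜 f B A t C` says that `C = t ∘ A ∘ (B₁,…,Bₙ)`, where the blocks of
variables `(G₁,…,G_{m₁}), (G_{m₁+1},…,G_{m₂}), …` are the fibers of the monotone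
surjection `f : Fin M → Fin n` (this encodes naturals `1 ≤ m₁ < ⋯ < mₙ = M`). -/
def IsBlockComp {n M : ℕ} {G : Fin M → Type} [∀ j, NormedAddCommGroup (G j)]
    [∀ j, NormedSpace 𝕜 (G j)] {E : Fin n → Type} [∀ i, NormedAddCommGroup (E i)]
    [∀ i, NormedSpace 𝕜 (E i)] {F H0 : Type} [NormedAddCommGroup F] [NormedSpace 𝕜 F]
    [NormedAddCommGroup H0] [NormedSpace 𝕜 H0]
    (f : Fin M → Fin n)
    (B : ∀ i : Fin n, ContinuousMultilinearMap 𝕜 (fun j : {j : Fin M // f j = i} => G j.1) (E i))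
    (A : ContinuousMultilinearMap 𝕜 E F) (t : F →L[𝕜] H0)
    (C : ContinuousMultilinearMap 𝕜 G H0) : Prop :=
  ∀ x : ∀ j, G j, C x = t (A fun i => B i fun j => x j.1)

/-- `((x_j^1,…,x_j^n))_j` converges multilinearly to `(x₁,…,xₙ)`:
`T(x_j^1,…,x_j^n) → T(x₁,…,xₙ)` for every continuous `n`-linear form `T`. -/
def ConvergesMultilinearly {n : ℕ} {E : Fin n → Type} [∀ i, NormedAddCommGroup (E i)]
    [∀ i, NormedSpace 𝕜 (E i)] (x : ℕ → ∀ i, E i) (xl : ∀ i, E i) : Prop :=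
  ∀ T : ContinuousMultilinearMap 𝕜 E 𝕜,
    Tendsto (fun j => T (x j)) atTop (𝓝 (T xl))

/-- Multilinearly sequentially continuous operators: multilinearly convergent sequences
are mapped to norm convergent sequences. -/
def IsMSC {n : ℕ} {E : Fin n → Type} [∀ i, NormedAddCommGroup (E i)]
    [∀ i, NormedSpace 𝕜 (E i)] {F : Type} [NormedAddCommGroup F] [NormedSpace 𝕜 F]
    (A : ContinuousMultilinearMap 𝕜 E F) : Prop :=
  ∀ (x : ℕ → ∀ i, E i) (xl : ∀ i, E i), ConvergesMultilinearly 𝕜 x xl →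
    Tendsto (fun j => A (x j)) atTop (𝓝 (A xl))

section Auxiliary

variable {𝕜}
variable {n : ℕ} {E : Fin n → Type} [∀ i, NormedAddCommGroup (E i)] [∀ i, NormedSpace 𝕜 (E i)]
  {F : Type} [NormedAddCommGroup F] [NormedSpace 𝕜 F]

/-- A multilinearly convergent sequence is uniformly bounded as a family of evaluations. -/
theorem ConvergesMultilinearly.exists_norm_apply_le {x : ℕ → ∀ i, E i} {xl : ∀ i, E i}
    (hx : ConvergesMultilinearly 𝕜 x xl) (F : Type) [NormedAddCommGroup F] [NormedSpace 𝕜 F] :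
    ∃ K : ℝ, ∀ (A : ContinuousMultilinearMap 𝕜 E F) (j : ℕ), ‖A (x j)‖ ≤ K * ‖A‖ := by
  obtain ⟨K, hK⟩ := banach_steinhaus
    (g := fun j => ContinuousMultilinearMap.apply 𝕜 E 𝕜 (x j)) fun T => by
      obtain ⟨C, hC⟩ := (hx T).norm.bddAbove_range
      exact ⟨C, fun j => hC ⟨j, rfl⟩⟩
  refine ⟨K, fun A j => ?_⟩
  obtain ⟨φ, hφ, hφA⟩ := exists_dual_vector'' 𝕜 (A (x j))
  calc ‖A (x j)‖ = ‖φ (A (x j))‖ := by rw [hφA]; simp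
    _ = ‖ContinuousMultilinearMap.apply 𝕜 E 𝕜 (x j) (φ.compContinuousMultilinearMap A)‖ := rfl
    _ ≤ K * ‖φ.compContinuousMultilinearMap A‖ :=
        ContinuousLinearMap.le_of_opNorm_le _ (hK j) _
    _ ≤ K * ‖A‖ := by
        have hK0 : 0 ≤ K := (norm_nonneg _).trans (hK j)
        gcongr
        exact (φ.norm_compContinuousMultilinearMap_le A).trans
          (mul_le_of_le_one_left (norm_nonneg _) hφ)

theorem isClosed_setOf_isMSC : IsClosed {A : ContinuousMultilinearMap 𝕜 E F | IsMSC 𝕜 A} := by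
  refine isClosed_of_closure_subset fun A hA x xl hx => ?_
  obtain ⟨K, hK⟩ := hx.exists_norm_apply_le F
  rw [Metric.tendsto_atTop]
  intro ε hε
  have hlim : Tendsto (fun B : ContinuousMultilinearMap 𝕜 E F =>
      K * ‖A - B‖ + ‖A xl - B xl‖) (𝓝 A) (𝓝 0) := by
    have : Continuous fun B : ContinuousMultilinearMap 𝕜 E F =>
        K * ‖A - B‖ + ‖A xl - B xl‖ := by
      have : Continuous fun B : ContinuousMultilinearMap 𝕜 E F => B xl :=
        (ContinuousMultilinearMap.apply 𝕜 E F xl).continuous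
      fun_prop
    simpa using this.tendsto A
  obtain ⟨B, hBA, hB⟩ := ((mem_closure_iff_frequently.1 hA).and_eventually
    (hlim.eventually_lt_const (half_pos hε))).exists
  obtain ⟨N, hN⟩ := Metric.tendsto_atTop.1 (hBA x xl hx) (ε / 2) (half_pos hε)
  refine ⟨N, fun j hj => ?_⟩
  have h₁ : dist (A (x j)) (B (x j)) ≤ K * ‖A - B‖ := by
    rw [dist_eq_norm]; exact hK (A - B) j
  have h₂ : dist (B xl) (A xl) = ‖A xl - B xl‖ := by rw [dist_comm, dist_eq_norm]
  linarith [hN j hj, dist_triangle4 (A (x j)) (B (x j)) (B xl) (A xl)]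

/-- A continuous multilinear map of finite rank is multilinearly sequentially continuous. -/
theorem IsFiniteRank.isMSC {A : ContinuousMultilinearMap 𝕜 E F} (hA : IsFiniteRank 𝕜 A) :
    IsMSC 𝕜 A := by
  intro x xl hx
  set S := Submodule.span 𝕜 (Set.range ⇑A)
  have : FiniteDimensional 𝕜 S := hA
  let A' := A.codRestrict S fun v => Submodule.subset_span ⟨v, rfl⟩
  let e := ContinuousLinearEquiv.ofFinrankEq (𝕜 := 𝕜) (E := S)
    (F := Fin (Module.finrank 𝕜 S) → 𝕜) (by simp)
  have h : Tendsto (fun j => e (A' (x j))) atTop (𝓝 (e (A' xl))) :=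
    tendsto_pi_nhds.2 fun k =>
      hx (((ContinuousLinearMap.proj (R := 𝕜) (φ := fun _ => 𝕜) k).comp
        e.toContinuousLinearMap).compContinuousMultilinearMap A')
  have hcomp := ((continuous_subtype_val.comp e.symm.continuous).tendsto _).comp h
  simpa [Function.comp_def, A'] using hcomp

/-- The composition of a continuous multilinear map with continuous multilinear maps acting on
the blocks of variables given by the fibers of `f`. -/
def ContinuousMultilinearMap.blockComp {M : ℕ} {G : Fin M → Type}
    [∀ j, NormedAddCommGroup (G j)] [∀ j, NormedSpace 𝕜 (G j)] (f : Fin M → Fin n)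
    (T : ContinuousMultilinearMap 𝕜 E F)
    (B : ∀ i, ContinuousMultilinearMap 𝕜 (fun j : {j : Fin M // f j = i} => G j.1) (E i)) :
    ContinuousMultilinearMap 𝕜 G F :=
  have key : ∀ (x : ∀ j, G j) (k : Fin M) (v : G k),
      (fun i => B i fun j => Function.update x k v j.1) =
        Function.update (fun i => B i fun j => x j.1) (f k)
          (B (f k) (Function.update (fun j : {j // f j = f k} => x j.1) ⟨k, rfl⟩ v)) := by
    intro x k v
    funext i
    by_cases hi : i = f k
    · subst hi
      rw [Function.update_self]
      congr 1
      funext j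
      by_cases hj : j = ⟨k, rfl⟩
      · subst hj; simp
      · rw [Function.update_of_ne hj, Function.update_of_ne fun h => hj (Subtype.ext h)]
    · rw [Function.update_of_ne hi]
      congr 1
      funext j
      exact Function.update_of_ne (fun h => hi (by rw [← j.2, h])) _ _
  { toFun := fun x => T fun i => B i fun j => x j.1
    map_update_add' := fun {inst} x k v w => by
      obtain rfl := Subsingleton.elim inst (instDecidableEqFin M)
      simp only [key, map_update_add]
    map_update_smul' := fun {inst} x k c v => by
      obtain rfl := Subsingleton.elim inst (instDecidableEqFin M)
      simp only [key, map_update_smul]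
    cont := by
      refine T.cont.comp (continuous_pi fun i => (B i).cont.comp ?_)
      exact continuous_pi fun j => continuous_apply j.1 }

end Auxiliary

/-- The multilinearly sequentially continuous operators form a closed hyper-ideal whose
linear component is the ideal of completely continuous operators, and this class
contains the composition class `CC ∘ L`. -/
theorem msc_closed_hyperIdeal :
    -- (a) each component is a linear subspace containing the finite-rank operators and
    -- closed in the operator norm
    (∀ (n : ℕ) (E : Fin n → Type) [∀ i, NormedAddCommGroup (E i)]
      [∀ i, NormedSpace 𝕜 (E i)] [∀ i, CompleteSpace (E i)]
      (F : Type) [NormedAddCommGroup F] [NormedSpace 𝕜 F] [CompleteSpace F],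
      IsMSC 𝕜 (0 : ContinuousMultilinearMap 𝕜 E F) ∧
      (∀ A B : ContinuousMultilinearMap 𝕜 E F, IsMSC 𝕜 A → IsMSC 𝕜 B → IsMSC 𝕜 (A + B)) ∧
      (∀ (c : 𝕜) (A : ContinuousMultilinearMap 𝕜 E F), IsMSC 𝕜 A → IsMSC 𝕜 (c • A)) ∧
      (∀ A : ContinuousMultilinearMap 𝕜 E F, IsFiniteRank 𝕜 A → IsMSC 𝕜 A) ∧
      IsClosed {A : ContinuousMultilinearMap 𝕜 E F | IsMSC 𝕜 A}) ∧
    -- (b) the hyper-ideal property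
    (∀ (n M : ℕ) (G : Fin M → Type) [∀ j, NormedAddCommGroup (G j)]
      [∀ j, NormedSpace 𝕜 (G j)] [∀ j, CompleteSpace (G j)]
      (E : Fin n → Type) [∀ i, NormedAddCommGroup (E i)] [∀ i, NormedSpace 𝕜 (E i)]
      [∀ i, CompleteSpace (E i)]
      (F H0 : Type) [NormedAddCommGroup F] [NormedSpace 𝕜 F] [CompleteSpace F]
      [NormedAddCommGroup H0] [NormedSpace 𝕜 H0] [CompleteSpace H0]
      (f : Fin M → Fin n), Monotone f → Function.Surjective f →
      ∀ (B : ∀ i : Fin n, ContinuousMultilinearMap 𝕜 (fun j : {j : Fin M // f j = i} => G j.1) (E i))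
        (A : ContinuousMultilinearMap 𝕜 E F), IsMSC 𝕜 A →
      ∀ (t : F →L[𝕜] H0) (C : ContinuousMultilinearMap 𝕜 G H0),
        IsBlockComp 𝕜 f B A t C → IsMSC 𝕜 C) ∧
    -- (c) a continuous linear operator is multilinearly sequentially continuous iff it
    -- is completely continuous
    (∀ (E F : Type) [NormedAddCommGroup E] [NormedSpace 𝕜 E] [CompleteSpace E]
      [NormedAddCommGroup F] [NormedSpace 𝕜 F] [CompleteSpace F]
      (u : E →L[𝕜] F) (A : ContinuousMultilinearMap 𝕜 (fun _ : Fin 1 => E) F),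
      (∀ x, A x = u (x 0)) →
      (IsMSC 𝕜 A ↔ ∀ (x : ℕ → E) (xl : E),
        (∀ φ : E →L[𝕜] 𝕜, Tendsto (fun j => φ (x j)) atTop (𝓝 (φ xl))) →
        Tendsto (fun j => u (x j)) atTop (𝓝 (u xl)))) ∧
    -- (d) `CC ∘ L` is contained in the multilinearly sequentially continuous operators
    (∀ (n : ℕ) (E : Fin n → Type) [∀ i, NormedAddCommGroup (E i)]
      [∀ i, NormedSpace 𝕜 (E i)] [∀ i, CompleteSpace (E i)]
      (Gs F : Type) [NormedAddCommGroup Gs] [NormedSpace 𝕜 Gs] [CompleteSpace Gs]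
      [NormedAddCommGroup F] [NormedSpace 𝕜 F] [CompleteSpace F]
      (B : ContinuousMultilinearMap 𝕜 E Gs) (u : Gs →L[𝕜] F),
      (∀ (x : ℕ → Gs) (xl : Gs),
        (∀ φ : Gs →L[𝕜] 𝕜, Tendsto (fun j => φ (x j)) atTop (𝓝 (φ xl))) →
        Tendsto (fun j => u (x j)) atTop (𝓝 (u xl))) →
      ∀ A : ContinuousMultilinearMap 𝕜 E F, (∀ x, A x = u (B x)) → IsMSC 𝕜 A) := by
  refine ⟨fun n E _ _ _ F _ _ _ => ⟨fun x xl _ => by simp, fun A B hA hB x xl hx => ?_,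
    fun c A hA x xl hx => ?_, fun A hA => hA.isMSC, isClosed_setOf_isMSC⟩, ?_, ?_, ?_⟩
  · simpa using (hA x xl hx).add (hB x xl hx)
  · simpa using (hA x xl hx).const_smul c
  · intro n M G _ _ _ E _ _ _ F H0 _ _ _ _ _ _ f _ _ B A hA t C hC x xl hx
    simp only [hC _]
    exact (t.continuous.tendsto _).comp (hA _ _ fun T => hx (T.blockComp f B))
  · intro E F _ _ _ _ _ _ u A hAu
    refine ⟨fun hA x xl hx => ?_, fun hu x xl hx => ?_⟩
    · simpa [hAu] using hA (fun j _ => x j) (fun _ => xl) fun T =>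
        hx ((ContinuousMultilinearMap.ofSubsingleton 𝕜 E 𝕜 (0 : Fin 1)).symm T)
    · simp only [hAu]
      exact hu _ _ fun φ => hx (ContinuousMultilinearMap.ofSubsingleton 𝕜 E 𝕜 (0 : Fin 1) φ)
  · intro n E _ _ _ Gs F _ _ _ _ _ _ B u hu A hA x xl hx
    simp only [hA]
    exact hu _ _ fun φ => hx (φ.compContinuousMultilinearMap B)

end
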